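/- arXiv:1804.06803 — 3 statements merged into one kernel-verified Lean document; each statement's English description precedes it below -/
import Mathlib

section
/- Let F = Σ_{r=0}^{q−1} Σ_{s=0}^{q−1} f_{rs} · u^r · v^s with continuous coefficients f_{rs} : T² → ℂ. Then F is κ-ρ-equivariant, i.e. F(λ^m·z₁, λ^n·z₂) = R^m·S^n·F(z₁,z₂)·S^{−n}·R^{−m} for all integers m, n and all (z₁,z₂) ∈ T², if and only if every coefficient f_{rs} is κ-invariant, i.e. f_{rs}(λ^m·z₁, λ^n·z₂) = f_{rs}(z₁,z₂) for all integers m, n and all (z₁,z₂) ∈ T². -/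
open Matrix

noncomputable section

/-- `λ = exp(2πi·p/q)`, as an element of the unit circle. -/
def lamC (q : ℕ) (p : ℤ) : Circle := Circle.exp (2 * Real.pi * ((p : ℝ) / (q : ℝ)))

/-- `λ = exp(2πi·p/q)`, as a complex number. -/
def lam (q : ℕ) (p : ℤ) : ℂ := lamC q p

/-- The clock matrix `R`. -/
def Rmat (q : ℕ) (p : ℤ) [NeZero q] : Matrix (ZMod q) (ZMod q) ℂ :=
  Matrix.diagonal fun j => lam q p ^ j.val

/-- The shift matrix `S`. -/
def Smat (q : ℕ) [NeZero q] : Matrix (ZMod q) (ZMod q) ℂ :=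
  Matrix.of fun j k => if j = k + 1 then 1 else 0

/-- `u(z₁,z₂) = z₁·S`, as a continuous `M_q(ℂ)`-valued function on the 2-torus. -/
def uC (q : ℕ) [NeZero q] : C(Circle × Circle, Matrix (ZMod q) (ZMod q) ℂ) :=
  ⟨fun z => (z.1 : ℂ) • Smat q, by fun_prop⟩

/-- `v(z₁,z₂) = z₂·R⁻¹`, as a continuous `M_q(ℂ)`-valued function on the 2-torus. -/
def vC (q : ℕ) (p : ℤ) [NeZero q] : C(Circle × Circle, Matrix (ZMod q) (ZMod q) ℂ) :=
  ⟨fun z => (z.2 : ℂ) • (Rmat q p)⁻¹, by fun_prop⟩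

theorem lam_prim (q : ℕ) [NeZero q] (p : ℤ) (hpq : Int.gcd p q = 1) :
    IsPrimitiveRoot (lam q p) q := by
  have h := (Complex.isPrimitiveRoot_exp q (NeZero.ne q)).zpow_of_gcd_eq_one p hpq
  have e : lam q p = Complex.exp (2 * Real.pi * Complex.I / q) ^ p := by
    rw [← Complex.exp_int_mul, lam, lamC, Circle.coe_exp]
    congr 1
    push_cast
    ring
  rw [e]
  exact h

theorem lam_pow_q (q : ℕ) [NeZero q] (p : ℤ) : lam q p ^ q = 1 := by
  have hq : (q : ℂ) ≠ 0 := by exact_mod_cast NeZero.ne q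
  rw [lam, lamC, Circle.coe_exp, ← Complex.exp_nat_mul, Complex.exp_eq_one_iff]
  refine ⟨p, ?_⟩
  push_cast
  field_simp

/-- the character `j ↦ λ^j` of `ℤ/q`. -/
def ech (q : ℕ) (p : ℤ) [NeZero q] : AddChar (ZMod q) ℂ := AddChar.zmodChar q (lam_pow_q q p)

theorem ech_val (q : ℕ) (p : ℤ) [NeZero q] (j : ZMod q) : ech q p j = lam q p ^ j.val := rfl

theorem ech_ne (q : ℕ) (p : ℤ) [NeZero q] (j : ZMod q) : ech q p j ≠ 0 := by
  rw [ech_val]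
  exact pow_ne_zero _ (Circle.coe_ne_zero _)

theorem ech_int (q : ℕ) (p : ℤ) [NeZero q] (n : ℤ) : ech q p n = lam q p ^ n := by
  have h1 : ech q p 1 = lam q p := by
    have := AddChar.zmodChar_apply' (lam_pow_q q p) 1
    simpa [ech] using this
  have := AddChar.map_zsmul_eq_zpow (ech q p) n 1
  simpa [h1] using this

def Dm (q : ℕ) (p : ℤ) [NeZero q] (a : ZMod q) : Matrix (ZMod q) (ZMod q) ℂ :=
  Matrix.diagonal fun j => ech q p (a * j)

def Tm (q : ℕ) [NeZero q] (a : ZMod q) : Matrix (ZMod q) (ZMod q) ℂ :=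
  Matrix.of fun j k => if j = k + a then 1 else 0

theorem Dm_mul (q : ℕ) (p : ℤ) [NeZero q] (a b : ZMod q) : Dm q p a * Dm q p b = Dm q p (a + b) := by
  simp [Dm, Matrix.diagonal_mul_diagonal, add_mul, AddChar.map_add_eq_mul]

theorem Dm_zero (q : ℕ) (p : ℤ) [NeZero q] : Dm q p 0 = 1 := by
  simp [Dm]

theorem Tm_mul (q : ℕ) [NeZero q] (a b : ZMod q) : Tm q a * Tm q b = Tm q (a + b) := by
  ext j k
  simp [Tm, Matrix.mul_apply, add_assoc, add_comm a b]

theorem Tm_zero (q : ℕ) [NeZero q] : Tm q 0 = 1 := by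
  ext j k
  simp [Tm, Matrix.one_apply]

theorem DT (q : ℕ) (p : ℤ) [NeZero q] (a b : ZMod q) :
    Dm q p a * Tm q b = ech q p (a * b) • (Tm q b * Dm q p a) := by
  ext j k
  simp only [Dm, Tm, Matrix.diagonal_mul, Matrix.mul_diagonal, Matrix.smul_apply, Matrix.of_apply]
  split_ifs with h
  · subst h
    simp [mul_add, AddChar.map_add_eq_mul, mul_comm]
  · simp

theorem fam_zpow {ι : Type*} [Fintype ι] [DecidableEq ι] {q : ℕ} (T : ZMod q → Matrix ι ι ℂ)
    (h0 : T 0 = 1) (h : ∀ a b, T a * T b = T (a + b)) (a : ZMod q) (n : ℤ) :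
    T a ^ n = T (n * a) := by
  have hn : ∀ n : ℕ, T a ^ n = T (n * a) := by
    intro n
    induction n with
    | zero => simp [h0]
    | succ k ih => rw [pow_succ, ih, h]; congr 1; push_cast; ring
  obtain ⟨k, rfl | rfl⟩ := n.eq_nat_or_neg
  · simpa using hn k
  · rw [Matrix.zpow_neg_natCast, hn]
    apply Matrix.inv_eq_right_inv
    rw [h, ← h0]
    congr 1
    push_cast
    ring

theorem R_eq (q : ℕ) (p : ℤ) [NeZero q] : Rmat q p = Dm q p 1 := by
  simp [Rmat, Dm, ech_val]

theorem S_eq (q : ℕ) [NeZero q] : Smat q = Tm q 1 := rfl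

theorem R_zpow (q : ℕ) (p : ℤ) [NeZero q] (n : ℤ) : Rmat q p ^ n = Dm q p n := by
  rw [R_eq, fam_zpow (Dm q p) (Dm_zero q p) (Dm_mul q p), mul_one]

theorem S_zpow (q : ℕ) [NeZero q] (n : ℤ) : Smat q ^ n = Tm q n := by
  rw [S_eq, fam_zpow (Tm q) (Tm_zero q) (Tm_mul q), mul_one]

theorem conj_W (q : ℕ) (p : ℤ) [NeZero q] (m n r s : ZMod q) :
    Dm q p m * Tm q n * (Tm q r * Dm q p (-s)) * Tm q (-n) * Dm q p (-m)
      = (ech q p (m * r) * ech q p (n * s)) • (Tm q r * Dm q p (-s)) := by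
  have e1 : Dm q p m * Tm q n * (Tm q r * Dm q p (-s)) * Tm q (-n) * Dm q p (-m)
      = (Dm q p m * Tm q (n + r)) * (Dm q p (-s) * Tm q (-n)) * Dm q p (-m) := by
    rw [← Tm_mul]; simp only [Matrix.mul_assoc]
  have e2 : Tm q (n + r) * Dm q p m * (Tm q (-n) * Dm q p (-s)) * Dm q p (-m)
      = Tm q (n + r) * (Dm q p m * Tm q (-n)) * (Dm q p (-s) * Dm q p (-m)) := by
    simp only [Matrix.mul_assoc]
  have e3 : Tm q (n + r) * (Tm q (-n) * Dm q p m) * Dm q p (-s + -m)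
      = (Tm q (n + r) * Tm q (-n)) * (Dm q p m * Dm q p (-s + -m)) := by
    simp only [Matrix.mul_assoc]
  rw [e1, DT, DT q p (-s)]
  simp only [Matrix.smul_mul, Matrix.mul_smul]
  rw [e2, DT, Dm_mul]
  simp only [Matrix.smul_mul, Matrix.mul_smul]
  rw [e3, Tm_mul, Dm_mul, smul_smul, smul_smul]
  simp only [← AddChar.map_add_eq_mul]
  congr 2
  · ring
  · congr 1; ring
  · congr 1; ring

/-- linear independence -/
theorem W_indep (q : ℕ) (p : ℤ) [NeZero q] (hpq : Int.gcd p q = 1) (c : Fin q × Fin q → ℂ)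
    (hc : ∑ rs : Fin q × Fin q, c rs • (Tm q ((rs.1 : ℕ) : ZMod q) * Dm q p (-((rs.2 : ℕ) : ZMod q))) = 0) :
    c = 0 := by
  have hprim := lam_prim q p hpq
  have castinj : ∀ a b : Fin q, ((a : ℕ) : ZMod q) = ((b : ℕ) : ZMod q) → a = b := by
    intro a b h
    have := congrArg ZMod.val h
    rw [ZMod.val_cast_of_lt a.2, ZMod.val_cast_of_lt b.2] at this
    exact Fin.ext this
  have einj : ∀ x y : ZMod q, ech q p x = ech q p y → x = y := by
    intro x y h
    rw [ech_val, ech_val] at h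
    exact ZMod.val_injective q (hprim.pow_inj (ZMod.val_lt x) (ZMod.val_lt y) h)
  have key : ∀ r k : Fin q, ∑ s : Fin q, c (r, s) * ech q p (-((k : ℕ) : ZMod q)) ^ (s : ℕ) = 0 := by
    intro r k
    have h := congrFun (congrFun hc (((k : ℕ) : ZMod q) + ((r : ℕ) : ZMod q))) ((k : ℕ) : ZMod q)
    rw [Matrix.sum_apply, Fintype.sum_prod_type, Finset.sum_eq_single r] at h
    · rw [Matrix.zero_apply] at h
      rw [← h]
      refine Finset.sum_congr rfl fun s _ => ?_
      rw [← AddChar.map_nsmul_eq_pow]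
      simp [Tm, Dm, Matrix.mul_diagonal]
    · intro b _ hb
      refine Finset.sum_eq_zero fun s _ => ?_
      have : ¬ (((r : ℕ) : ZMod q) = ((b : ℕ) : ZMod q)) := fun h => hb (castinj _ _ h).symm
      simp [Tm, Dm, Matrix.mul_diagonal, this]
    · simp
  funext ⟨r, s⟩
  have := Matrix.eq_zero_of_forall_index_sum_mul_pow_eq_zero
    (f := fun k : Fin q => ech q p (-((k : ℕ) : ZMod q))) (v := fun s => c (r, s))
    (fun a b h => castinj a b (neg_injective (einj _ _ h))) (fun k => key r k)
  exact congrFun this s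

theorem stmt_13 (q : ℕ) [NeZero q] (p : ℤ) (hpq : Int.gcd p q = 1)
    (f : Fin q × Fin q → C(Circle × Circle, ℂ))
    (F : C(Circle × Circle, Matrix (ZMod q) (ZMod q) ℂ))
    (hF : F = ∑ rs : Fin q × Fin q, f rs • (uC q ^ (rs.1 : ℕ) * vC q p ^ (rs.2 : ℕ))) :
    (∀ (m n : ℤ) (z : Circle × Circle),
        F (lamC q p ^ m * z.1, lamC q p ^ n * z.2)
          = Rmat q p ^ m * Smat q ^ n * F z * Smat q ^ (-n) * Rmat q p ^ (-m))
      ↔ ∀ (rs : Fin q × Fin q) (m n : ℤ) (z : Circle × Circle),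
          f rs (lamC q p ^ m * z.1, lamC q p ^ n * z.2) = f rs z := by
  have hFz : ∀ z : Circle × Circle, F z = ∑ rs : Fin q × Fin q,
      (f rs z * ((z.1 : ℂ) ^ (rs.1 : ℕ) * (z.2 : ℂ) ^ (rs.2 : ℕ))) •
        (Tm q ((rs.1 : ℕ) : ZMod q) * Dm q p (-((rs.2 : ℕ) : ZMod q))) := by
    intro z
    rw [hF, ContinuousMap.sum_apply]
    refine Finset.sum_congr rfl fun rs _ => ?_
    have h1 : Smat q ^ (rs.1 : ℕ) = Tm q ((rs.1 : ℕ) : ZMod q) := by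
      have := S_zpow q (rs.1 : ℕ)
      simpa using this
    have h2 : (Rmat q p)⁻¹ ^ (rs.2 : ℕ) = Dm q p (-((rs.2 : ℕ) : ZMod q)) := by
      have := R_zpow q p (-((rs.2 : ℕ) : ℤ))
      rw [Matrix.zpow_neg_natCast, ← Matrix.inv_pow'] at this
      simpa using this
    have h3 : (f rs • (uC q ^ (rs.1 : ℕ) * vC q p ^ (rs.2 : ℕ))) z
      = f rs z • (((z.1 : ℂ) • Smat q) ^ (rs.1 : ℕ) * ((z.2 : ℂ) • (Rmat q p)⁻¹) ^ (rs.2 : ℕ)) := rfl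
    rw [h3, smul_pow, smul_pow, h1, h2, Matrix.smul_mul, Matrix.mul_smul, smul_smul, smul_smul,
      mul_assoc]
  have hL : ∀ (m n : ℤ) (z : Circle × Circle), F (lamC q p ^ m * z.1, lamC q p ^ n * z.2)
      - Rmat q p ^ m * Smat q ^ n * F z * Smat q ^ (-n) * Rmat q p ^ (-m)
      = ∑ rs : Fin q × Fin q,
      ((f rs (lamC q p ^ m * z.1, lamC q p ^ n * z.2) - f rs z) *
        (((z.1 : ℂ) ^ (rs.1 : ℕ) * (z.2 : ℂ) ^ (rs.2 : ℕ)) *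
         (ech q p (m * (rs.1 : ℕ)) * ech q p (n * (rs.2 : ℕ))))) •
        (Tm q ((rs.1 : ℕ) : ZMod q) * Dm q p (-((rs.2 : ℕ) : ZMod q))) := by
    intro m n z
    rw [hFz, hFz z, R_zpow, S_zpow, R_zpow, S_zpow]
    push_cast
    rw [Matrix.mul_sum, Matrix.sum_mul, Matrix.sum_mul, ← Finset.sum_sub_distrib]
    refine Finset.sum_congr rfl fun rs _ => ?_
    rw [Matrix.mul_smul, Matrix.smul_mul, Matrix.smul_mul, conj_W, smul_smul, ← sub_smul]
    congr 1
    have h1 : ∀ (m : ℤ) (k : ℕ), ech q p (m * k) = (lam q p ^ m) ^ k := by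
      intro m k
      rw [← ech_int, ← AddChar.map_nsmul_eq_pow, nsmul_eq_mul, mul_comm]
    rw [h1, h1]
    simp only [lam]
    ring
  constructor
  · intro h rs m n z
    have h0 := hL m n z
    rw [h m n z, sub_self] at h0
    have h1 := congrFun (W_indep q p hpq _ h0.symm) rs
    simp only [Pi.zero_apply] at h1
    refine sub_eq_zero.1 ((mul_eq_zero.1 h1).resolve_right ?_)
    exact mul_ne_zero (mul_ne_zero (pow_ne_zero _ (Circle.coe_ne_zero _))
      (pow_ne_zero _ (Circle.coe_ne_zero _))) (mul_ne_zero (ech_ne _ _ _) (ech_ne _ _ _))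
  · intro h m n z
    rw [← sub_eq_zero, hL]
    refine Finset.sum_eq_zero fun rs _ => ?_
    rw [h rs m n z, sub_self, zero_mul, zero_smul]
end
end

section
/- There is no continuous map h : T² → T² such that for all (w,z) ∈ T², the first component of h(w,z) equals w² and the square of the second component of h(w,z) equals z. (Hence the double covering (w,z) ↦ (w², z) of T² is not equivalent to the double covering (w,z) ↦ (w, z²), corresponding to inequivalence of the spin structures labelled (1,0) and (0,1).) -/
/-- The double covering `(w,z) ↦ (w², z)` of the 2-torus is not equivalent to the
double covering `(w,z) ↦ (w, z²)`. -/
theorem stmt_17 :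
    ¬∃ h : Circle × Circle → Circle × Circle, Continuous h ∧
      ∀ w z : Circle, (h (w, z)).1 = w ^ 2 ∧ ((h (w, z)).2) ^ 2 = z := by
  rintro ⟨h, hc, hh⟩
  set g : ℝ → ℂ := fun t => (((h (1, Circle.exp t)).2 / Circle.exp (t / 2) : Circle) : ℂ) with hg
  have gc : Continuous g := by
    have h1 : Continuous fun t : ℝ => Circle.exp t := Circle.exp.continuous
    have h2 : Continuous fun t : ℝ => Circle.exp (t / 2) :=
      Circle.exp.continuous.comp (continuous_id.div_const 2)
    have h3 : Continuous fun t : ℝ => (h (1, Circle.exp t)).2 :=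
      continuous_snd.comp (hc.comp (continuous_const.prodMk h1))
    exact continuous_subtype_val.comp (h3.div' h2)
  have gsq : ∀ t, g t ^ 2 = 1 := by
    intro t
    have e : Circle.exp (t / 2) ^ 2 = Circle.exp t := by
      rw [pow_two, ← Circle.exp_add, add_halves]
    have : ((h (1, Circle.exp t)).2 / Circle.exp (t / 2)) ^ 2 = 1 := by
      rw [div_pow, (hh 1 _).2, e, div_self']
    have h2 := congrArg (fun x : Circle => (x : ℂ)) this
    simpa [hg] using h2
  have gend : g (2 * Real.pi) = - g 0 := by
    simp only [hg]
    have e : Circle.exp (2 * Real.pi) = Circle.exp 0 := by simp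
    have e2 : 2 * Real.pi / 2 = Real.pi := by ring
    rw [e, e2]
    simp [Circle.coe_exp, Complex.exp_pi_mul_I, div_neg]
  have rc : Continuous fun t => (g t).re := Complex.continuous_re.comp gc
  have mem : (0 : ℝ) ∈ Set.range fun t => (g t).re := by
    have hend : (g (2 * Real.pi)).re = - (g 0).re := by rw [gend, Complex.neg_re]
    rcases le_total (g 0).re 0 with h0 | h0
    · exact mem_range_of_exists_le_of_exists_ge rc ⟨0, h0⟩ ⟨2 * Real.pi, by linarith⟩
    · exact mem_range_of_exists_le_of_exists_ge rc ⟨2 * Real.pi, by linarith⟩ ⟨0, h0⟩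
  obtain ⟨t, ht⟩ := mem
  rcases (mul_self_eq_one_iff.mp ((pow_two (g t)).symm.trans (gsq t))) with h1 | h1 <;> simp [h1] at ht
end

section
/- There is no continuous map h : T² → T² such that for all (w,z) ∈ T², the square of the first component of h(w,z) equals w·z and the second component of h(w,z) equals w·z⁻¹. (Hence the diagonal double covering (w,z) ↦ (w·z, w·z⁻¹) of T² is not equivalent to the double covering (w,z) ↦ (w², z), corresponding to inequivalence of the spin structures labelled (1,1) and (1,0).) -/
/-- The diagonal double covering `(w,z) ↦ (w·z, w·z⁻¹)` of the 2-torus is not equivalent to the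
double covering `(w,z) ↦ (w², z)`. -/
theorem stmt_18 :
    ¬∃ h : Circle × Circle → Circle × Circle, Continuous h ∧
      ∀ w z : Circle, ((h (w, z)).1) ^ 2 = w * z ∧ (h (w, z)).2 = w * z⁻¹ := by
  rintro ⟨h, hc, hh⟩
  let F : ℝ → ℂ := fun t => ((h (Circle.exp t, 1)).1 : ℂ)
  let G : ℝ → ℂ := fun t => (Circle.exp (t / 2) : ℂ)
  have hF : Continuous F := by
    have h1 : Continuous fun t : ℝ => Circle.exp t := Circle.exp.continuous
    exact continuous_subtype_val.comp (continuous_fst.comp (hc.comp (h1.prodMk continuous_const)))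
  have hG : Continuous G :=
    continuous_subtype_val.comp (Circle.exp.continuous.comp (continuous_id.div_const 2))
  have hsq : Set.EqOn (F ^ 2) (G ^ 2) Set.univ := by
    intro t _
    have h1 := (hh (Circle.exp t) 1).1
    have h2 : Circle.exp (t / 2) ^ 2 = Circle.exp t := by
      rw [sq, ← Circle.exp_add]; congr 1; ring
    replace h1 := (h1.trans (mul_one _)).trans h2.symm
    have h3 := congrArg (fun x : Circle => (x : ℂ)) h1
    simpa [F, G] using h3
  have hper : F (2 * Real.pi) = F 0 := by simp [F]
  have hG0 : G 0 = 1 := by simp [G]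
  have hG1 : G (2 * Real.pi) = -1 := by
    simp [G, Circle.coe_exp]
  rcases isPreconnected_univ.eq_or_eq_neg_of_sq_eq hF.continuousOn hG.continuousOn hsq
    (fun {t} _ => Circle.coe_ne_zero _) with e | e
  · have a := e (Set.mem_univ 0)
    have b := e (Set.mem_univ (2 * Real.pi))
    rw [hper, a, hG0, hG1] at b
    norm_num at b
  · have a := e (Set.mem_univ 0)
    have b := e (Set.mem_univ (2 * Real.pi))
    rw [hper, a, Pi.neg_apply, Pi.neg_apply, hG0, hG1] at b
    norm_num at b
end
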